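/- arXiv:2004.14655 — 2 statements merged into one kernel-verified Lean document; each statement's English description precedes it below -/
import Mathlib

section
/- Let K be a compact Hausdorff space and let 𝒢_1, …, 𝒢_q be a finite sequence of finite families of nonempty open subsets of K, each with at least two elements, with chosen functions f_G as in the context. Then there exists a martingale setup and a C(K)-valued discrete martingale (M_0, …, M_{2q}) on a probability space (Ω, Σ, p) such that: (1) Ω_{2r} = Ω for r = 1, …, q; (2) for every ω ∈ Ω and r = 1, …, q, either dM_{2r}(ω) ∈ 𝓕_{𝒢_r} or −dM_{2r}(ω) ∈ 𝓕_{𝒢_r}; and (3) ‖M_{2q}(ω)‖_∞ ≤ 1 + ∑_{r=1}^q l(𝒢_r)/(|𝒢_r| − 1) for all ω ∈ Ω. -/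
open MeasureTheory Filter Topology

/-- A martingale setup: a sequence of finite measurable partitions of `Ω`, each refining
the previous one. -/
structure MartingaleSetup (Ω : Type*) [MeasurableSpace Ω] (p : Measure Ω) where
  part : ℕ → Finset (Set Ω)
  meas : ∀ n, ∀ E ∈ part n, MeasurableSet E
  disj : ∀ n, (↑(part n) : Set (Set Ω)).PairwiseDisjoint id
  cover : ∀ n, ⋃₀ (↑(part n) : Set (Set Ω)) = Set.univ
  refines : ∀ n, ∀ E ∈ part (n + 1), ∃ F ∈ part n, E ⊆ F

namespace MartingaleSetup

variable {Ω : Type*} [MeasurableSpace Ω] {p : Measure Ω}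

/-- Membership in the algebra `𝒜_n` generated by the `n`-th partition. -/
def MemAlg (S : MartingaleSetup Ω p) (n : ℕ) (E : Set Ω) : Prop :=
  ∃ T : Finset (Set Ω), T ⊆ S.part n ∧ E = ⋃₀ (↑T : Set (Set Ω))

/-- `Ω_k`: the union of all `k`-Walsh-Paley pairs, i.e. pairs `E₁, E₂ ∈ ℰ_k` with
`p E₁ = p E₂` and `E₁ ∪ E₂ ∈ ℰ_{k-1}`. -/
def wpUnion (S : MartingaleSetup Ω p) (k : ℕ) : Set Ω :=
  ⋃₀ {E | ∃ E₁ E₂ : Set Ω, E₁ ∈ S.part k ∧ E₂ ∈ S.part k ∧ p E₁ = p E₂ ∧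
      E₁ ∪ E₂ ∈ S.part (k - 1) ∧ (E = E₁ ∨ E = E₂)}

end MartingaleSetup

/-- A discrete martingale adapted to a martingale setup: each `M n` is constant on every
element of the `n`-th partition, and the increment `dM n = M n - M (n-1)` has zero integral
on every element of the algebra generated by the `(n-1)`-st partition (stated through
continuous linear functionals, so that it makes sense in any normed space). -/
def IsSimpleMartingale {Ω X : Type*} [MeasurableSpace Ω] {p : Measure Ω}
    [NormedAddCommGroup X] [NormedSpace ℝ X]
    (S : MartingaleSetup Ω p) (M : ℕ → Ω → X) : Prop :=
  (∀ n, ∀ E ∈ S.part n, ∀ ω ∈ E, ∀ ω' ∈ E, M n ω = M n ω') ∧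
  (∀ n, 1 ≤ n → ∀ E : Set Ω, S.MemAlg (n - 1) E → ∀ φ : X →L[ℝ] ℝ,
    ∫ ω in E, φ (M n ω - M (n - 1) ω) ∂p = 0)

/-- `l(𝒟)`: the least `k` such that every subfamily of `𝒟` with more than `k` members
has empty intersection. -/
noncomputable def interNum {α : Type*} (D : Finset (Set α)) : ℕ :=
  sInf {k : ℕ | ∀ A : Finset (Set α), A ⊆ D → k < A.card → ⋂₀ (↑A : Set (Set α)) = ∅}

/-- A discrete martingale with values in `X` over some martingale setup on some
probability space. -/
structure MartingaleData (X : Type*) [NormedAddCommGroup X] [NormedSpace ℝ X] where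
  (Ω : Type)
  [mΩ : MeasurableSpace Ω]
  (p : Measure Ω)
  (prob : IsProbabilityMeasure p)
  (S : MartingaleSetup Ω p)
  (M : ℕ → Ω → X)
  (mart : IsSimpleMartingale S M)

attribute [instance] MartingaleData.mΩ

section CosetMartingale

variable {Ω : Type*} [AddCommGroup Ω]

/-- The coset of `ω` modulo `H`. -/
def cosetOf (H : AddSubgroup Ω) (ω : Ω) : Set Ω := {ω' | ω' - ω ∈ H}

theorem mem_cosetOf_self (H : AddSubgroup Ω) (ω : Ω) : ω ∈ cosetOf H ω := by
  simp [cosetOf, H.zero_mem]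

theorem add_mem_cosetOf_iff {H : AddSubgroup Ω} {v : Ω} (hv : v ∈ H) (ω ω' : Ω) :
    ω' + v ∈ cosetOf H ω ↔ ω' ∈ cosetOf H ω := by
  simp only [cosetOf, Set.mem_ofPred_eq]
  rw [show ω' + v - ω = (ω' - ω) + v by abel]
  exact H.add_mem_cancel_right hv

variable [Fintype Ω] [MeasurableSpace Ω] [DiscreteMeasurableSpace Ω]

/-- The partitions of a finite group into cosets of a decreasing sequence of subgroups. -/
noncomputable def cosetSetup (p : Measure Ω) (H : ℕ → AddSubgroup Ω) (hH : Antitone H) :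
    MartingaleSetup Ω p where
  part n := (Set.finite_range (cosetOf (H n))).toFinset
  meas _ _ _ := MeasurableSet.of_discrete
  disj n := by
    intro E hE F hF hne
    simp only [Set.Finite.coe_toFinset, Set.mem_range] at hE hF
    obtain ⟨a, rfl⟩ := hE
    obtain ⟨b, rfl⟩ := hF
    refine Set.disjoint_left.2 fun c hca hcb => hne ?_
    simp only [id, cosetOf, Set.mem_ofPred_eq] at hca hcb
    have hab : a - b ∈ H n := by
      rw [show a - b = (c - b) - (c - a) by abel]
      exact (H n).sub_mem hcb hca
    ext x
    simp only [cosetOf, Set.mem_ofPred_eq]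
    rw [show x - b = (x - a) + (a - b) by abel]
    exact ((H n).add_mem_cancel_right hab).symm
  cover n := by
    refine Set.eq_univ_of_forall fun ω => ⟨cosetOf (H n) ω, ?_, mem_cosetOf_self _ _⟩
    simp
  refines n E hE := by
    simp only [Set.Finite.mem_toFinset, Set.mem_range] at hE
    obtain ⟨a, rfl⟩ := hE
    exact ⟨cosetOf (H n) a, by simp, fun x hx => hH n.le_succ hx⟩

theorem mem_cosetSetup_part {p : Measure Ω} {H : ℕ → AddSubgroup Ω} {hH : Antitone H} {n : ℕ}
    {E : Set Ω} : E ∈ (cosetSetup p H hH).part n ↔ ∃ ω, cosetOf (H n) ω = E := by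
  simp [cosetSetup]

/-- The uniform probability measure on a finite type. -/
noncomputable def uniformMeasure (Ω : Type*) [Fintype Ω] [MeasurableSpace Ω] : Measure Ω :=
  (Fintype.card Ω : ENNReal)⁻¹ • Measure.count

instance isProbabilityMeasure_uniformMeasure : IsProbabilityMeasure (uniformMeasure Ω) := by
  constructor
  have h : Measure.count (Set.univ : Set Ω) = (Fintype.card Ω : ENNReal) := by
    rw [← Finset.coe_univ, Measure.count_apply_finset]
    rfl
  rw [uniformMeasure, Measure.smul_apply, h, smul_eq_mul]
  exact ENNReal.inv_mul_cancel (by simp) (by simp)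

/-- A set integral vanishes if the translates of the integrand along a finite family of
translations preserving the set sum up to zero. -/
theorem setIntegral_uniformMeasure_eq_zero {J : Type*} [Fintype J] [Nonempty J] (v : J → Ω)
    {E : Set Ω} (hE : ∀ j ω, ω + v j ∈ E ↔ ω ∈ E) {F : Ω → ℝ}
    (hF : ∀ ω, ∑ j, F (ω + v j) = 0) : ∫ ω in E, F ω ∂(uniformMeasure Ω) = 0 := by
  classical
  rw [uniformMeasure, Measure.restrict_smul, integral_smul_measure,
    ← integral_indicator MeasurableSet.of_discrete, integral_count]
  have key : (Fintype.card J : ℝ) * ∑ ω, E.indicator F ω = 0 := by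
    calc (Fintype.card J : ℝ) * ∑ ω, E.indicator F ω
        = ∑ _j : J, ∑ ω, E.indicator F ω := by simp
      _ = ∑ j : J, ∑ ω, E.indicator F (ω + v j) :=
          Finset.sum_congr rfl fun j _ =>
            (Equiv.sum_comp (Equiv.addRight (v j)) (E.indicator F)).symm
      _ = ∑ ω, ∑ j : J, E.indicator F (ω + v j) := Finset.sum_comm
      _ = 0 := Finset.sum_eq_zero fun ω _ => by
          by_cases hω : ω ∈ E
          · rw [← hF ω]
            exact Finset.sum_congr rfl fun j _ => Set.indicator_of_mem ((hE j ω).2 hω) _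
          · exact Finset.sum_eq_zero fun j _ =>
              Set.indicator_of_notMem (fun h => hω ((hE j ω).1 h)) _
  have hJ : (Fintype.card J : ℝ) ≠ 0 := by simp
  rw [(mul_eq_zero.1 key).resolve_left hJ, smul_zero]

theorem isSimpleMartingale_cosetSetup {X : Type*} [NormedAddCommGroup X] [NormedSpace ℝ X]
    {H : ℕ → AddSubgroup Ω} (hH : Antitone H) {M : ℕ → Ω → X}
    (hM : ∀ n ω, ∀ v ∈ H n, M n (ω + v) = M n ω)
    (hd : ∀ n, ∃ (J : Type) (_ : Fintype J) (_ : Nonempty J) (v : J → Ω), (∀ j, v j ∈ H n) ∧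
      ∀ ω, ∑ j, (M (n + 1) (ω + v j) - M n (ω + v j)) = 0) :
    IsSimpleMartingale (cosetSetup (uniformMeasure Ω) H hH) M := by
  refine ⟨fun n E hE ω hω ω' hω' => ?_, fun n hn E hE φ => ?_⟩
  · obtain ⟨a, rfl⟩ := mem_cosetSetup_part.1 hE
    have h1 := hM n a _ hω
    have h2 := hM n a _ hω'
    rw [add_sub_cancel] at h1 h2
    rw [h1, h2]
  · obtain ⟨n, rfl⟩ := Nat.exists_eq_add_of_le' hn
    rw [Nat.add_sub_cancel] at hE ⊢
    obtain ⟨J, _, _, v, hv, hsum⟩ := hd n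
    refine setIntegral_uniformMeasure_eq_zero v (fun j ω => ?_) fun ω => ?_
    · obtain ⟨T, hT, rfl⟩ := hE
      simp only [Set.mem_sUnion]
      refine exists_congr fun F => and_congr_right fun hF => ?_
      obtain ⟨a, rfl⟩ := mem_cosetSetup_part.1 (hT hF)
      exact add_mem_cosetOf_iff (hv j) _ _
    · rw [← map_sum, hsum, map_zero]

theorem wpUnion_cosetSetup_eq_univ {H : ℕ → AddSubgroup Ω} (hH : Antitone H) {n : ℕ} {t : Ω}
    (ht : ∀ v, v ∈ H n ↔ v ∈ H (n + 1) ∨ v - t ∈ H (n + 1)) :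
    (cosetSetup (uniformMeasure Ω) H hH).wpUnion (n + 1) = Set.univ := by
  refine Set.eq_univ_of_forall fun ω => ⟨cosetOf (H (n + 1)) ω,
    ⟨cosetOf (H (n + 1)) ω, cosetOf (H (n + 1)) (ω + t), mem_cosetSetup_part.2 ⟨_, rfl⟩,
      mem_cosetSetup_part.2 ⟨_, rfl⟩, ?_, mem_cosetSetup_part.2 ⟨ω, ?_⟩, Or.inl rfl⟩,
    mem_cosetOf_self _ _⟩
  · have himage : cosetOf (H (n + 1)) (ω + t) = (· + t) '' cosetOf (H (n + 1)) ω := by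
      ext x
      simp only [cosetOf, Set.image_add_right, Set.mem_preimage, Set.mem_ofPred_eq]
      rw [show x + -t - ω = x - (ω + t) by abel]
    simp only [uniformMeasure, Measure.smul_apply]
    rw [himage, Measure.count_injective_image (add_left_injective t)]
  · ext x
    simp only [Set.mem_union, cosetOf, Set.mem_ofPred_eq, Nat.add_sub_cancel]
    rw [ht, sub_add_eq_sub_sub]

end CosetMartingale

section CoordinateSubgroups

variable {q : ℕ} {α : Fin q → Type} [∀ i, AddCommGroup (α i)]

/-- The sequences of choices and signs whose first `n` entries vanish, where the entries are
listed as choice, sign, choice, sign, and so on. -/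
def vanishing (α : Fin q → Type) [∀ i, AddCommGroup (α i)] (n : ℕ) :
    AddSubgroup (∀ i, α i × ZMod 2) where
  carrier := {v | ∀ i : Fin q, (2 * (i : ℕ) + 1 ≤ n → (v i).1 = 0) ∧
    (2 * (i : ℕ) + 2 ≤ n → (v i).2 = 0)}
  add_mem' := by
    intro a b ha hb i
    exact ⟨fun h => by simp [(ha i).1 h, (hb i).1 h], fun h => by simp [(ha i).2 h, (hb i).2 h]⟩
  zero_mem' := fun i => by simp
  neg_mem' := by
    intro a ha i
    exact ⟨fun h => by simp [(ha i).1 h], fun h => by simp [(ha i).2 h]⟩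

theorem mem_vanishing {n : ℕ} {v : ∀ i, α i × ZMod 2} :
    v ∈ vanishing α n ↔ ∀ i : Fin q, (2 * (i : ℕ) + 1 ≤ n → (v i).1 = 0) ∧
      (2 * (i : ℕ) + 2 ≤ n → (v i).2 = 0) := Iff.rfl

theorem vanishing_antitone : Antitone (vanishing α) := fun _ _ hmn _ hv i =>
  ⟨fun h => (hv i).1 (h.trans hmn), fun h => (hv i).2 (h.trans hmn)⟩

theorem single_choice_mem_vanishing (r : Fin q) (a : α r) :
    (Pi.single r (a, 0) : ∀ i, α i × ZMod 2) ∈ vanishing α (2 * (r : ℕ)) := by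
  intro i
  rcases eq_or_ne i r with rfl | h
  · exact ⟨fun h => by omega, fun h => by omega⟩
  · simp [Pi.single_eq_of_ne h]

theorem single_sign_mem_vanishing (r : Fin q) (s : ZMod 2) :
    (Pi.single r (0, s) : ∀ i, α i × ZMod 2) ∈ vanishing α (2 * (r : ℕ) + 1) := by
  intro i
  rcases eq_or_ne i r with rfl | h
  · exact ⟨fun h => by simp, fun h => by omega⟩
  · simp [Pi.single_eq_of_ne h]

theorem mem_vanishing_odd_iff (r : Fin q) (v : ∀ i, α i × ZMod 2) :
    v ∈ vanishing α (2 * (r : ℕ) + 1) ↔ v ∈ vanishing α (2 * (r : ℕ) + 1 + 1) ∨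
      v - Pi.single r (0, 1) ∈ vanishing α (2 * (r : ℕ) + 1 + 1) := by
  constructor
  · intro hv
    have hs : ∀ s : ZMod 2, s = 0 ∨ s = 1 := by decide
    have step : ∀ w ∈ vanishing α (2 * (r : ℕ) + 1), (w r).2 = 0 →
        w ∈ vanishing α (2 * (r : ℕ) + 1 + 1) := by
      intro w hw hwr i
      refine ⟨fun h => (hw i).1 (by omega), fun h => ?_⟩
      rcases eq_or_ne i r with rfl | hir
      · exact hwr
      · have : (i : ℕ) ≠ r := fun h => hir (Fin.ext h)
        exact (hw i).2 (by omega)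
    rcases hs (v r).2 with h | h
    · exact Or.inl (step v hv h)
    · exact Or.inr (step _ (AddSubgroup.sub_mem _ hv (single_sign_mem_vanishing r 1))
        (by simp [h]))
  · rintro (h | h)
    · exact vanishing_antitone (Nat.le_succ _) h
    · have := AddSubgroup.add_mem _ (vanishing_antitone (Nat.le_succ _) h)
        (single_sign_mem_vanishing r 1)
      rwa [sub_add_cancel] at this

end CoordinateSubgroups

section Steps

variable {K : Type*} [TopologicalSpace K]

/-- Truncation of a function to the interval `[-1, 1]`. -/
def clip (g : C(K, ℝ)) : C(K, ℝ) := (g ⊓ 1) ⊔ -1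

theorem clip_apply (g : C(K, ℝ)) (x : K) : clip g x = max (min (g x) 1) (-1) := rfl

theorem abs_clip_apply_le_one (g : C(K, ℝ)) (x : K) : |clip g x| ≤ 1 := by
  rw [clip_apply, abs_le]
  exact ⟨le_max_right _ _, max_le (min_le_right _ _) (by norm_num)⟩

theorem abs_sub_mul_max_min_add_mul_le {g f s B : ℝ} (hg : |g| ≤ B) (hB : 1 ≤ B) (hf0 : 0 ≤ f)
    (hf1 : f ≤ 1) (hs : |s| ≤ 1) : |g - f * max (min g 1) (-1) + s * f| ≤ B := by
  rw [abs_le] at hg hs ⊢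
  rcases le_total g 1 with h1 | h1
  · rcases le_total (-1) g with h2 | h2
    · rw [min_eq_left h1, max_eq_left h2]
      constructor <;> nlinarith
    · rw [min_eq_left h1, max_eq_right h2]
      constructor <;> nlinarith
  · rw [min_eq_right h1, max_eq_left (by norm_num)]
    constructor <;> nlinarith

/-- The centered increment which removes the truncation of `g` at the peak of `f j`. -/
noncomputable def centeredStep {ι : Type*} [Fintype ι] (f : ι → C(K, ℝ)) (g : C(K, ℝ)) (j : ι) :
    C(K, ℝ) :=
  (Fintype.card ι : ℝ)⁻¹ • (∑ i, f i * clip g) - f j * clip g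

theorem sum_centeredStep {ι : Type*} [Fintype ι] [Nonempty ι] (f : ι → C(K, ℝ)) (g : C(K, ℝ)) :
    ∑ j, centeredStep f g j = 0 := by
  have h : (Fintype.card ι : ℝ) ≠ 0 := by simp
  simp only [centeredStep, Finset.sum_sub_distrib, Finset.sum_const, Finset.card_univ]
  rw [← Nat.cast_smul_eq_nsmul ℝ, smul_smul, mul_inv_cancel₀ h, one_smul, sub_self]

theorem norm_add_centeredStep_add_smul_le [CompactSpace K] {ι : Type*} [Fintype ι]
    {f : ι → C(K, ℝ)} (hf0 : ∀ i x, 0 ≤ f i x) (hf1 : ∀ i x, f i x ≤ 1) {L B : ℝ}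
    (hL : ∀ x, ∑ i, f i x ≤ L) (hL0 : 0 ≤ L) {g : C(K, ℝ)} (hg : ‖g‖ ≤ B) (hB : 1 ≤ B)
    (j : ι) {s : ℝ} (hs : |s| ≤ 1) :
    ‖g + centeredStep f g j + s • f j‖ ≤ B + L / Fintype.card ι := by
  have hdiv : 0 ≤ L / Fintype.card ι := by positivity
  refine (ContinuousMap.norm_le _ (by linarith)).2 fun x => ?_
  have hgx : |g x| ≤ B := (g.norm_coe_le_norm x).trans hg
  have h1 := abs_sub_mul_max_min_add_mul_le hgx hB (hf0 j x) (hf1 j x) hs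
  rw [← clip_apply] at h1
  have h2 : |(Fintype.card ι : ℝ)⁻¹ * ((∑ i, f i x) * clip g x)| ≤ L / Fintype.card ι := by
    rw [abs_mul, abs_mul, abs_of_nonneg (Finset.sum_nonneg fun i _ => hf0 i x),
      abs_of_nonneg (by positivity : (0 : ℝ) ≤ (Fintype.card ι : ℝ)⁻¹), div_eq_inv_mul]
    refine mul_le_mul_of_nonneg_left ?_ (by positivity)
    calc (∑ i, f i x) * |clip g x| ≤ (∑ i, f i x) * 1 :=
          mul_le_mul_of_nonneg_left (abs_clip_apply_le_one g x)
            (Finset.sum_nonneg fun i _ => hf0 i x)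
      _ ≤ L := by rw [mul_one]; exact hL x
  have heq : (g + centeredStep f g j + s • f j) x =
      (g x - f j x * clip g x + s * f j x) +
        (Fintype.card ι : ℝ)⁻¹ * ((∑ i, f i x) * clip g x) := by
    simp only [centeredStep, ContinuousMap.add_apply, ContinuousMap.sub_apply,
      ContinuousMap.smul_apply, ContinuousMap.sum_apply, ContinuousMap.mul_apply, smul_eq_mul,
      Finset.sum_mul]
    ring
  rw [heq, Real.norm_eq_abs]
  exact (abs_add_le _ _).trans (add_le_add h1 h2)

theorem sum_le_interNum {X : Type*} (D : Finset (Set X)) {f : Set X → X → ℝ}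
    (hf1 : ∀ G ∈ D, ∀ x, f G x ≤ 1) (hf0 : ∀ G ∈ D, ∀ x ∉ G, f G x = 0) (x : X) :
    ∑ G ∈ D, f G x ≤ interNum D := by
  classical
  have hmem : interNum D ∈ {k : ℕ | ∀ A : Finset (Set X), A ⊆ D → k < A.card →
      ⋂₀ (↑A : Set (Set X)) = ∅} :=
    Nat.sInf_mem ⟨D.card, fun A hA h => absurd (Finset.card_le_card hA) (not_le.2 h)⟩
  have hcard : (D.filter (x ∈ ·)).card ≤ interNum D := by
    by_contra! h
    have hempty := hmem _ (Finset.filter_subset _ _) h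
    have hx : x ∈ ⋂₀ (↑(D.filter (x ∈ ·)) : Set (Set X)) := by
      intro G hG
      exact (Finset.mem_filter.1 hG).2
    rw [hempty] at hx
    exact hx
  calc ∑ G ∈ D, f G x ≤ ∑ G ∈ D, if x ∈ G then (1 : ℝ) else 0 := by
        refine Finset.sum_le_sum fun G hG => ?_
        split_ifs with h
        · exact hf1 G hG x
        · exact (hf0 G hG x h).le
    _ = ((D.filter (x ∈ ·)).card : ℝ) := by rw [Finset.sum_boole]
    _ ≤ interNum D := by exact_mod_cast hcard

/-- The sign `±1` coded by an element of `ZMod 2`. -/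
noncomputable def zmodSign (s : ZMod 2) : ℝ := if s = 0 then 1 else -1

theorem zmodSign_add_one (s : ZMod 2) : zmodSign (s + 1) = -zmodSign s := by
  simp only [zmodSign]
  have h : ∀ s : ZMod 2, s = 0 ∧ ¬ s + 1 = 0 ∨ ¬ s = 0 ∧ s + 1 = 0 := by decide
  rcases h s with ⟨h1, h2⟩ | ⟨h1, h2⟩
  · rw [if_pos h1, if_neg h2]
  · rw [if_neg h1, if_pos h2, neg_neg]

theorem zmodSign_eq_or (s : ZMod 2) : zmodSign s = 1 ∨ zmodSign s = -1 := ite_eq_or_eq _ _ _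

theorem abs_zmodSign (s : ZMod 2) : |zmodSign s| = 1 := by
  rcases zmodSign_eq_or s with h | h <;> simp [h]

end Steps

section Walk

variable {K : Type*} [TopologicalSpace K] {q : ℕ} {α : Fin q → Type} [∀ i, Fintype (α i)]

/-- The walk adding, at each stage `r < q`, a centered increment and a signed function. -/
noncomputable def walk (f : ∀ i, α i → C(K, ℝ)) : ℕ → (∀ i, α i × ZMod 2) → C(K, ℝ)
  | 0, _ => 0
  | r + 1, ω => if h : r < q then
      walk f r ω + centeredStep (f ⟨r, h⟩) (walk f r ω) (ω ⟨r, h⟩).1 +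
        zmodSign (ω ⟨r, h⟩).2 • f ⟨r, h⟩ (ω ⟨r, h⟩).1
    else walk f r ω

theorem walk_succ (f : ∀ i, α i → C(K, ℝ)) (r : Fin q) (ω : ∀ i, α i × ZMod 2) :
    walk f (r + 1) ω = walk f r ω + centeredStep (f r) (walk f r ω) (ω r).1 +
      zmodSign (ω r).2 • f r (ω r).1 := by
  rw [walk, dif_pos r.2]

theorem walk_succ_of_le (f : ∀ i, α i → C(K, ℝ)) {r : ℕ} (hr : q ≤ r)
    (ω : ∀ i, α i × ZMod 2) : walk f (r + 1) ω = walk f r ω := by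
  rw [walk, dif_neg hr.not_gt]

/-- The walk after `r` stages and the centered increment of the next stage. -/
noncomputable def halfwayWalk (f : ∀ i, α i → C(K, ℝ)) (r : ℕ) (ω : ∀ i, α i × ZMod 2) :
    C(K, ℝ) :=
  if h : r < q then walk f r ω + centeredStep (f ⟨r, h⟩) (walk f r ω) (ω ⟨r, h⟩).1
  else walk f r ω

/-- The walk with the centered increment and the signed function as separate steps. -/
noncomputable def refinedWalk (f : ∀ i, α i → C(K, ℝ)) (n : ℕ) (ω : ∀ i, α i × ZMod 2) :
    C(K, ℝ) :=
  if n % 2 = 0 then walk f (n / 2) ω else halfwayWalk f (n / 2) ω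

theorem refinedWalk_two_mul (f : ∀ i, α i → C(K, ℝ)) (r : ℕ) (ω : ∀ i, α i × ZMod 2) :
    refinedWalk f (2 * r) ω = walk f r ω := by
  have h : 2 * r / 2 = r := by omega
  simp [refinedWalk, h]

theorem refinedWalk_two_mul_add_one (f : ∀ i, α i → C(K, ℝ)) (r : Fin q)
    (ω : ∀ i, α i × ZMod 2) : refinedWalk f (2 * (r : ℕ) + 1) ω =
      walk f r ω + centeredStep (f r) (walk f r ω) (ω r).1 := by
  have h : (2 * (r : ℕ) + 1) / 2 = r := by omega
  rw [refinedWalk, if_neg (by omega), h, halfwayWalk, dif_pos r.2]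

theorem refinedWalk_two_mul_add_one_of_le (f : ∀ i, α i → C(K, ℝ)) {r : ℕ} (hr : q ≤ r)
    (ω : ∀ i, α i × ZMod 2) : refinedWalk f (2 * r + 1) ω = walk f r ω := by
  have h : (2 * r + 1) / 2 = r := by omega
  rw [refinedWalk, if_neg (by omega), h, halfwayWalk, dif_neg hr.not_gt]

theorem refinedWalk_even_sub (f : ∀ i, α i → C(K, ℝ)) (r : Fin q) (ω : ∀ i, α i × ZMod 2) :
    refinedWalk f (2 * (r : ℕ) + 1 + 1) ω - refinedWalk f (2 * (r : ℕ) + 1) ω =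
      zmodSign (ω r).2 • f r (ω r).1 := by
  rw [show 2 * (r : ℕ) + 1 + 1 = 2 * (r + 1) by ring, refinedWalk_two_mul, walk_succ,
    refinedWalk_two_mul_add_one, add_sub_cancel_left]

theorem norm_walk_le [CompactSpace K] {f : ∀ i, α i → C(K, ℝ)} (hf0 : ∀ i j x, 0 ≤ f i j x)
    (hf1 : ∀ i j x, f i j x ≤ 1) {L : Fin q → ℝ} (hL : ∀ i x, ∑ j, f i j x ≤ L i)
    (hL0 : ∀ i, 0 ≤ L i) (ω : ∀ i, α i × ZMod 2) :
    ‖walk f q ω‖ ≤ 1 + ∑ i, L i / Fintype.card (α i) := by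
  have hnn : ∀ i, 0 ≤ L i / Fintype.card (α i) := fun i => div_nonneg (hL0 i) (by positivity)
  have main : ∀ r ≤ q, ‖walk f r ω‖ ≤
      1 + ∑ i ∈ Finset.univ.filter (fun i : Fin q => (i : ℕ) < r),
        L i / Fintype.card (α i) := by
    intro r
    induction r with
    | zero => simp [walk]
    | succ r ih =>
      intro hr
      obtain ⟨r, rfl⟩ : ∃ s : Fin q, (s : ℕ) = r := ⟨⟨r, hr⟩, rfl⟩
      have hins : Finset.univ.filter (fun i : Fin q => (i : ℕ) < r + 1) =
          insert r (Finset.univ.filter (fun i : Fin q => (i : ℕ) < r)) := by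
        ext i
        simp only [Finset.mem_filter, Finset.mem_univ, true_and, Finset.mem_insert, Fin.ext_iff]
        omega
      rw [hins, Finset.sum_insert (by simp), walk_succ]
      have := norm_add_centeredStep_add_smul_le (hf0 r) (hf1 r) (hL r) (hL0 r)
        (ih (by omega)) (le_add_of_nonneg_right (Finset.sum_nonneg fun i _ => hnn i))
        (ω r).1 (abs_zmodSign (ω r).2).le
      linarith
  simpa using main q le_rfl

variable [∀ i, AddCommGroup (α i)]

theorem walk_add (f : ∀ i, α i → C(K, ℝ)) {r : ℕ} (ω : ∀ i, α i × ZMod 2)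
    {v : ∀ i, α i × ZMod 2} (hv : v ∈ vanishing α (2 * r)) : walk f r (ω + v) = walk f r ω := by
  induction r with
  | zero => rfl
  | succ r ih =>
    have ih := ih (vanishing_antitone (by omega) hv)
    by_cases h : r < q
    · have h1 := (hv ⟨r, h⟩).1 (by simp only; omega)
      have h2 := (hv ⟨r, h⟩).2 (by simp only; omega)
      have := walk_succ f ⟨r, h⟩
      simp only at this
      rw [this, this, ih]
      simp [h1, h2]
    · rw [walk_succ_of_le f (not_lt.1 h), walk_succ_of_le f (not_lt.1 h), ih]

theorem refinedWalk_add (f : ∀ i, α i → C(K, ℝ)) (n : ℕ) (ω : ∀ i, α i × ZMod 2)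
    (v : ∀ i, α i × ZMod 2) (hv : v ∈ vanishing α n) :
    refinedWalk f n (ω + v) = refinedWalk f n ω := by
  have hw := walk_add f ω (r := n / 2) (vanishing_antitone (by omega) hv)
  unfold refinedWalk halfwayWalk
  split_ifs with h0 h1
  · exact hw
  · rw [hw, Pi.add_apply, Prod.fst_add, (hv ⟨n / 2, h1⟩).1 (by simp only; omega), add_zero]
  · exact hw

theorem exists_sum_refinedWalk_sub_eq_zero (f : ∀ i, α i → C(K, ℝ)) (n : ℕ) :
    ∃ (J : Type) (_ : Fintype J) (_ : Nonempty J) (v : J → ∀ i, α i × ZMod 2),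
      (∀ j, v j ∈ vanishing α n) ∧
      ∀ ω, ∑ j, (refinedWalk f (n + 1) (ω + v j) - refinedWalk f n (ω + v j)) = 0 := by
  obtain ⟨r, rfl | rfl⟩ := n.even_or_odd'
  · by_cases h : r < q
    · obtain ⟨r, rfl⟩ : ∃ s : Fin q, (s : ℕ) = r := ⟨⟨r, h⟩, rfl⟩
      refine ⟨α r, inferInstance, inferInstance, fun a => Pi.single r (a, 0),
        single_choice_mem_vanishing r, fun ω => ?_⟩
      have : ∀ a : α r, refinedWalk f (2 * (r : ℕ) + 1) (ω + Pi.single r (a, 0)) -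
          refinedWalk f (2 * (r : ℕ)) (ω + Pi.single r (a, 0)) =
            centeredStep (f r) (walk f r ω) ((ω r).1 + a) := by
        intro a
        rw [refinedWalk_two_mul_add_one, refinedWalk_two_mul,
          walk_add f ω (single_choice_mem_vanishing r a), add_sub_cancel_left]
        simp
      simp only [this]
      rw [← sum_centeredStep (f r) (walk f r ω)]
      exact Equiv.sum_comp (Equiv.addLeft (ω r).1) (centeredStep (f r) (walk f r ω))
    · refine ⟨Unit, inferInstance, inferInstance, fun _ => 0, fun _ => zero_mem _, fun ω => ?_⟩
      simp [refinedWalk_two_mul_add_one_of_le f (not_lt.1 h), refinedWalk_two_mul]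
  · by_cases h : r < q
    · obtain ⟨r, rfl⟩ : ∃ s : Fin q, (s : ℕ) = r := ⟨⟨r, h⟩, rfl⟩
      refine ⟨Fin 2, inferInstance, inferInstance, ![0, Pi.single r (0, 1)], fun j => ?_,
        fun ω => ?_⟩
      · fin_cases j
        · exact zero_mem _
        · exact single_sign_mem_vanishing r 1
      · simp only [refinedWalk_even_sub, Fin.sum_univ_two]
        simp [zmodSign_add_one]
    · refine ⟨Unit, inferInstance, inferInstance, fun _ => 0, fun _ => zero_mem _, fun ω => ?_⟩
      rw [show 2 * r + 1 + 1 = 2 * (r + 1) by ring]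
      simp [refinedWalk_two_mul_add_one_of_le f (not_lt.1 h), refinedWalk_two_mul,
        walk_succ_of_le f (not_lt.1 h)]

end Walk

/-- Given finite families `𝒢_1, …, 𝒢_q` of nonempty open sets (each of size `≥ 2`),
there is a martingale `(M_0, …, M_{2q})` with `Ω_{2r} = Ω`, `±dM_{2r}(ω) ∈ ℱ_{𝒢_r}`, and
`‖M_{2q}(ω)‖∞ ≤ 1 + ∑_r l(𝒢_r)/(|𝒢_r| - 1)`. -/
theorem stmt16 {K : Type*} [TopologicalSpace K] [CompactSpace K] [T2Space K]
    (fG : Set K → C(K, ℝ))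
    (hfG : ∀ G : Set K, IsOpen G → G.Nonempty →
      (∀ x, 0 ≤ fG G x) ∧ (∀ x, fG G x ≤ 1) ∧ ‖fG G‖ = 1 ∧ ∀ x ∉ G, fG G x = 0)
    (q : ℕ) (𝒢 : Fin q → Finset (Set K))
    (h𝒢 : ∀ r, ∀ G ∈ 𝒢 r, IsOpen G ∧ G.Nonempty) (hcard : ∀ r, 2 ≤ (𝒢 r).card) :
    ∃ T : MartingaleData C(K, ℝ),
      (∀ r : Fin q, T.S.wpUnion (2 * ((r : ℕ) + 1)) = Set.univ) ∧
      (∀ ω, ∀ r : Fin q,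
        (∃ G ∈ 𝒢 r, T.M (2 * ((r : ℕ) + 1)) ω - T.M (2 * ((r : ℕ) + 1) - 1) ω = fG G) ∨
        (∃ G ∈ 𝒢 r, -(T.M (2 * ((r : ℕ) + 1)) ω - T.M (2 * ((r : ℕ) + 1) - 1) ω) = fG G)) ∧
      (∀ ω, ‖T.M (2 * q) ω‖ ≤
        1 + ∑ r : Fin q, (interNum (𝒢 r) : ℝ) / (((𝒢 r).card : ℝ) - 1)) := by
  have : ∀ r, NeZero (𝒢 r).card := fun r => ⟨by have := hcard r; omega⟩
  let e : ∀ r, Fin (𝒢 r).card ≃ 𝒢 r := fun r => (𝒢 r).equivFin.symm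
  let f : ∀ r, Fin (𝒢 r).card → C(K, ℝ) := fun r j => fG (e r j)
  let α : Fin q → Type := fun r => Fin (𝒢 r).card
  let : ∀ r, Fintype (α r) := fun r => inferInstanceAs (Fintype (Fin (𝒢 r).card))
  let : ∀ r, AddCommGroup (α r) := fun r => inferInstanceAs (AddCommGroup (Fin (𝒢 r).card))
  let : MeasurableSpace (∀ r, α r × ZMod 2) := ⊤
  have : DiscreteMeasurableSpace (∀ r, α r × ZMod 2) := ⟨fun _ => trivial⟩
  have hprop : ∀ r, ∀ G ∈ 𝒢 r, (∀ x, 0 ≤ fG G x) ∧ (∀ x, fG G x ≤ 1) ∧ ‖fG G‖ = 1 ∧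
      ∀ x ∉ G, fG G x = 0 := fun r G hG => hfG G (h𝒢 r G hG).1 (h𝒢 r G hG).2
  refine ⟨⟨∀ r, α r × ZMod 2, uniformMeasure _, inferInstance,
    cosetSetup _ (vanishing α) vanishing_antitone, refinedWalk f,
    isSimpleMartingale_cosetSetup vanishing_antitone (refinedWalk_add (α := α) f)
      (exists_sum_refinedWalk_sub_eq_zero (α := α) f)⟩, fun r => ?_, fun ω r => ?_, fun ω => ?_⟩
  · exact wpUnion_cosetSetup_eq_univ vanishing_antitone (mem_vanishing_odd_iff (α := α) r)
  · have hd := refinedWalk_even_sub (α := α) f r ω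
    rcases zmodSign_eq_or (ω r).2 with h | h
    · refine Or.inl ⟨e r (ω r).1, (e r (ω r).1).2, hd.trans ?_⟩
      rw [h, one_smul]
    · refine Or.inr ⟨e r (ω r).1, (e r (ω r).1).2, (congrArg Neg.neg hd).trans ?_⟩
      rw [h, neg_one_smul, neg_neg]
  · have hL : ∀ r x, ∑ j, f r j x ≤ (interNum (𝒢 r) : ℝ) := by
      intro r x
      calc ∑ j, f r j x = ∑ G : 𝒢 r, fG G x := Equiv.sum_comp (e r) fun G => fG G x
        _ = ∑ G ∈ 𝒢 r, fG G x := Finset.sum_coe_sort (𝒢 r) fun G => fG G x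
        _ ≤ interNum (𝒢 r) := sum_le_interNum (𝒢 r) (f := fun G x => fG G x)
            (fun G hG => (hprop r G hG).2.1) (fun G hG => (hprop r G hG).2.2.2) x
    have hw := norm_walk_le (α := α) (f := f) (fun r j => (hprop r _ (e r j).2).1)
      (fun r j => (hprop r _ (e r j).2).2.1) hL (fun r => Nat.cast_nonneg _) ω
    change ‖refinedWalk (α := α) f (2 * q) ω‖ ≤ _
    rw [refinedWalk_two_mul]
    refine hw.trans (add_le_add_right (Finset.sum_le_sum fun r _ => ?_) 1)
    have h2 : (2 : ℝ) ≤ ((𝒢 r).card : ℝ) := by exact_mod_cast hcard r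
    have hc : (Fintype.card (α r) : ℝ) = ((𝒢 r).card : ℝ) := by
      exact_mod_cast Fintype.card_fin _
    rw [hc]
    exact div_le_div_of_nonneg_left (Nat.cast_nonneg _) (by linarith) (by linarith)
end

section
/- Let K be a compact Hausdorff space, let 𝒢 be a family of nonempty open subsets of K with wĩn(𝒢) = 0, with chosen functions f_G as in the context, and let H ⊆ C(K) be a homogeneous set with 𝓕_𝒢 ⊆ H. Then a(H) ≤ 1; that is, for every k ≥ 1 and every ε > 0 there exists a C(K)-valued discrete martingale (M_n) belonging to Ξ̃_k(H) with sup_n E‖M_n‖_∞² ≤ (1 + ε)². -/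
open MeasureTheory Filter Topology

/-- Membership in `Ξ̃_k(H)`: there are at least `k` distinct indices `n ≥ 1` and measurable
sets `D n` with `dM n (D n) ⊆ H` and `∫_{D n ∩ Ω_n} ‖dM n‖² dp ≥ 1`. -/
def MemXi {Ω X : Type*} [MeasurableSpace Ω] {p : Measure Ω}
    [NormedAddCommGroup X] [NormedSpace ℝ X]
    (S : MartingaleSetup Ω p) (M : ℕ → Ω → X) (H : Set X) (k : ℕ) : Prop :=
  ∃ (N : Finset ℕ) (D : ℕ → Set Ω), k ≤ N.card ∧
    ∀ n ∈ N, 1 ≤ n ∧ MeasurableSet (D n) ∧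
      (∀ ω ∈ D n, M n ω - M (n - 1) ω ∈ H) ∧
      1 ≤ ∫ ω in D n ∩ S.wpUnion n, ‖M n ω - M (n - 1) ω‖ ^ 2 ∂p

/-- Homogeneous subset of a real vector space. -/
def IsHomogeneous {X : Type*} [AddCommGroup X] [Module ℝ X] (H : Set X) : Prop :=
  ∀ x ∈ H, ∀ r : ℝ, r • x ∈ H

/-- The martingale setup on a finite probability space given by the equivalence classes of a
decreasing sequence of equivalence relations. -/
noncomputable def MartingaleSetup.ofSetoids {Ω : Type*} [Finite Ω] [MeasurableSpace Ω]
    [DiscreteMeasurableSpace Ω] (p : Measure Ω) (r : ℕ → Setoid Ω)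
    (hr : ∀ n, r (n + 1) ≤ r n) : MartingaleSetup Ω p where
  part n := (Set.toFinite (r n).classes).toFinset
  meas _ _ _ := MeasurableSet.of_discrete
  disj n := by
    rw [Set.Finite.coe_toFinset]
    intro A hA B hB hAB
    refine Set.disjoint_left.2 fun x hxA hxB => hAB ?_
    exact Setoid.eq_of_mem_classes hA hxA hB hxB
  cover n := by
    rw [Set.Finite.coe_toFinset]
    exact Setoid.sUnion_classes _
  refines n E hE := by
    obtain ⟨y, rfl⟩ := (Set.Finite.mem_toFinset _).1 hE
    exact ⟨{x | r n x y}, (Set.Finite.mem_toFinset _).2 ⟨y, rfl⟩, fun x hx => hr n hx⟩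

namespace MartingaleSetup

variable {Ω : Type*} [Finite Ω] [MeasurableSpace Ω] [DiscreteMeasurableSpace Ω] {p : Measure Ω}
  {r : ℕ → Setoid Ω} {hr : ∀ n, r (n + 1) ≤ r n}

theorem mem_part_ofSetoids {n : ℕ} {E : Set Ω} :
    E ∈ (ofSetoids p r hr).part n ↔ E ∈ (r n).classes :=
  Set.Finite.mem_toFinset _

/-- Elements of the algebra generated by the classes of a relation are saturated. -/
theorem MemAlg.mem_iff_of_rel {n : ℕ} {E : Set Ω} (hE : (ofSetoids p r hr).MemAlg n E)
    {x y : Ω} (hxy : r n x y) : x ∈ E ↔ y ∈ E := by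
  obtain ⟨T, hT, rfl⟩ := hE
  have key : ∀ {x y : Ω}, r n x y → x ∈ ⋃₀ (↑T : Set (Set Ω)) → y ∈ ⋃₀ (↑T : Set (Set Ω)) := by
    rintro x y hxy ⟨A, hA, hx⟩
    refine ⟨A, hA, ?_⟩
    obtain ⟨z, rfl⟩ := mem_part_ofSetoids.1 (hT hA)
    exact (r n).trans' ((r n).symm' hxy) hx
  exact ⟨key hxy, key ((r n).symm' hxy)⟩

end MartingaleSetup

theorem uniformOn_univ_eq_smul_count {Ω : Type*} [MeasurableSpace Ω] :
    ProbabilityTheory.uniformOn (Set.univ : Set Ω)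
      = (Measure.count (Set.univ : Set Ω))⁻¹ • Measure.count := by
  simp [ProbabilityTheory.uniformOn, ProbabilityTheory.cond]

theorem uniformOn_univ_image_equiv {Ω : Type*} [MeasurableSpace Ω] [MeasurableSingletonClass Ω]
    (e : Ω ≃ Ω) (E : Set Ω) :
    ProbabilityTheory.uniformOn Set.univ (e '' E) = ProbabilityTheory.uniformOn Set.univ E := by
  simp only [uniformOn_univ_eq_smul_count, Measure.smul_apply,
    Measure.count_injective_image e.injective]

/-- If the average of `g` along a finite family of permutations preserving `E` vanishes, then so
does the integral of `g` over `E` for the uniform measure. -/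
theorem setIntegral_uniformOn_eq_zero_of_sum_perm {Ω ι : Type*} [Fintype Ω] [Fintype ι]
    [Nonempty ι] [MeasurableSpace Ω] [DiscreteMeasurableSpace Ω] (τ : ι → Ω ≃ Ω) (E : Set Ω)
    (hE : ∀ t ω, τ t ω ∈ E ↔ ω ∈ E) (g : Ω → ℝ) (hg : ∀ ω, ∑ t, g (τ t ω) = 0) :
    ∫ ω in E, g ω ∂(ProbabilityTheory.uniformOn Set.univ) = 0 := by
  classical
  rw [← integral_indicator MeasurableSet.of_discrete, uniformOn_univ_eq_smul_count,
    integral_smul_measure, integral_count]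
  have h1 : ∑ t : ι, ∑ ω, E.indicator g (τ t ω) = 0 := by
    rw [Finset.sum_comm]
    refine Finset.sum_eq_zero fun ω _ => ?_
    by_cases hω : ω ∈ E
    · simpa [Set.indicator, hE, hω] using hg ω
    · simp [Set.indicator, hE, hω]
  have h2 : ∀ t : ι, ∑ ω, E.indicator g (τ t ω) = ∑ ω, E.indicator g ω :=
    fun t => Equiv.sum_comp (τ t) _
  simp only [h2, Finset.sum_const, Finset.card_univ, nsmul_eq_mul] at h1
  have h3 : (Fintype.card ι : ℝ) ≠ 0 := by exact_mod_cast Fintype.card_ne_zero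
  rw [(mul_eq_zero.1 h1).resolve_left h3, smul_zero]

namespace AlternatingMartingale

/-- Agreement of the first `n` letters, where each coordinate contributes two letters. -/
def agree (k N n : ℕ) : Setoid (Fin k → Fin N × Fin 2) where
  r ω ω' := ∀ i : Fin k, (2 * (i : ℕ) < n → (ω i).1 = (ω' i).1) ∧
    (2 * (i : ℕ) + 1 < n → (ω i).2 = (ω' i).2)
  iseqv :=
    ⟨fun _ _ => ⟨fun _ => rfl, fun _ => rfl⟩,
      fun h i => ⟨fun hi => ((h i).1 hi).symm, fun hi => ((h i).2 hi).symm⟩,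
      fun h h' i => ⟨fun hi => ((h i).1 hi).trans ((h' i).1 hi),
        fun hi => ((h i).2 hi).trans ((h' i).2 hi)⟩⟩

theorem agree_iff {k N n : ℕ} {ω ω' : Fin k → Fin N × Fin 2} :
    agree k N n ω ω' ↔ ∀ i : Fin k, (2 * (i : ℕ) < n → (ω i).1 = (ω' i).1) ∧
      (2 * (i : ℕ) + 1 < n → (ω i).2 = (ω' i).2) :=
  Iff.rfl

theorem agree_succ_le (k N n : ℕ) : agree k N (n + 1) ≤ agree k N n :=
  fun _ _ h i => ⟨fun hi => (h i).1 (by omega), fun hi => (h i).2 (by omega)⟩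

/-- The real sign attached to a letter of `Fin 2`. -/
def sgn (s : Fin 2) : ℝ := if s = 0 then 1 else -1

theorem abs_sgn (s : Fin 2) : |sgn s| = 1 := by
  unfold sgn
  split_ifs <;> simp

variable {K : Type*} [TopologicalSpace K] {k N : ℕ}

/-- The average of a finite family of functions. -/
noncomputable def avg (f : Fin N → C(K, ℝ)) : C(K, ℝ) := (N : ℝ)⁻¹ • ∑ j, f j

/-- The `n`-th increment, as a function of the current value: at even times damp the value on
the support of a random function `f j`, at odd times add `± f j`. -/
noncomputable def increment (f : Fin N → C(K, ℝ)) (n : ℕ) (ω : Fin k → Fin N × Fin 2)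
    (x : C(K, ℝ)) : C(K, ℝ) :=
  if h : n / 2 < k then
    if n % 2 = 0 then x * (avg f - f (ω ⟨n / 2, h⟩).1)
    else sgn (ω ⟨n / 2, h⟩).2 • f (ω ⟨n / 2, h⟩).1
  else 0

/-- The martingale that alternately damps along and moves by `± f j`, for random `j`. -/
noncomputable def process (f : Fin N → C(K, ℝ)) : ℕ → (Fin k → Fin N × Fin 2) → C(K, ℝ)
  | 0, _ => 0
  | n + 1, ω => process f n ω + increment f n ω (process f n ω)

theorem increment_even (f : Fin N → C(K, ℝ)) (i : Fin k) (ω : Fin k → Fin N × Fin 2)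
    (x : C(K, ℝ)) : increment f (2 * i) ω x = x * (avg f - f (ω i).1) := by
  have h1 : 2 * (i : ℕ) / 2 = i := by omega
  simp [increment, h1]

theorem increment_odd (f : Fin N → C(K, ℝ)) (i : Fin k) (ω : Fin k → Fin N × Fin 2)
    (x : C(K, ℝ)) : increment f (2 * i + 1) ω x = sgn (ω i).2 • f (ω i).1 := by
  have h1 : (2 * (i : ℕ) + 1) / 2 = i := by omega
  have h2 : (2 * (i : ℕ) + 1) % 2 = 1 := by omega
  simp [increment, h1, h2]

theorem increment_of_le (f : Fin N → C(K, ℝ)) {n : ℕ} (hn : 2 * k ≤ n)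
    (ω : Fin k → Fin N × Fin 2) (x : C(K, ℝ)) : increment f n ω x = 0 := by
  have h : ¬ n / 2 < k := by omega
  simp [increment, h]

theorem process_sub (f : Fin N → C(K, ℝ)) (n : ℕ) (ω : Fin k → Fin N × Fin 2) :
    process f (n + 1) ω - process f n ω = increment f n ω (process f n ω) := by
  simp [process]

theorem process_congr (f : Fin N → C(K, ℝ)) {n : ℕ} {ω ω' : Fin k → Fin N × Fin 2}
    (h : agree k N n ω ω') : process f n ω = process f n ω' := by
  induction n with
  | zero => rfl
  | succ n ih =>
    have e := ih (agree_succ_le k N n h)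
    simp only [process, e]
    congr 1
    rw [agree_iff] at h
    unfold increment
    split_ifs with h1 h2
    · rw [(h ⟨n / 2, h1⟩).1 (by simp only; omega)]
    · rw [(h ⟨n / 2, h1⟩).1 (by simp only; omega), (h ⟨n / 2, h1⟩).2 (by simp only; omega)]
    · rfl

/-- Translation of a single coordinate. -/
def shift [NeZero N] (i : Fin k) (a : Fin N × Fin 2) :
    (Fin k → Fin N × Fin 2) ≃ (Fin k → Fin N × Fin 2) :=
  Equiv.addRight (Pi.single i a)

theorem shift_apply_same [NeZero N] (i : Fin k) (a : Fin N × Fin 2)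
    (ω : Fin k → Fin N × Fin 2) : shift i a ω i = ω i + a := by
  simp [shift]

theorem shift_apply_ne [NeZero N] {i j : Fin k} (h : j ≠ i) (a : Fin N × Fin 2)
    (ω : Fin k → Fin N × Fin 2) : shift i a ω j = ω j := by
  simp [shift, h]

theorem agree_shift_even [NeZero N] (i : Fin k) (a : Fin N × Fin 2)
    (ω : Fin k → Fin N × Fin 2) : agree k N (2 * i) (shift i a ω) ω := by
  rw [agree_iff]
  intro j
  by_cases h : j = i
  · subst h
    exact ⟨fun h => by omega, fun h => by omega⟩
  · simp [shift_apply_ne h]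

theorem agree_shift_odd [NeZero N] (i : Fin k) (s : Fin 2)
    (ω : Fin k → Fin N × Fin 2) : agree k N (2 * i + 1) (shift i (0, s) ω) ω := by
  rw [agree_iff]
  intro j
  by_cases h : j = i
  · subst h
    simp [shift_apply_same]
  · simp [shift_apply_ne h]

theorem sum_sub_avg [NeZero N] (f : Fin N → C(K, ℝ)) : ∑ j, (avg f - f j) = 0 := by
  have hN : (N : ℝ) ≠ 0 := by exact_mod_cast NeZero.ne N
  rw [Finset.sum_sub_distrib, Finset.sum_const, Finset.card_univ, Fintype.card_fin, avg,
    ← Nat.cast_smul_eq_nsmul ℝ, smul_smul, mul_inv_cancel₀ hN, one_smul, sub_self]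

theorem sum_increment_even [NeZero N] (f : Fin N → C(K, ℝ)) (i : Fin k)
    (ω : Fin k → Fin N × Fin 2) (x : C(K, ℝ)) :
    ∑ t : Fin N, increment f (2 * i) (shift i (t, 0) ω) x = 0 := by
  simp only [increment_even, shift_apply_same, Prod.fst_add, ← Finset.mul_sum]
  have h := Equiv.sum_comp (Equiv.addLeft (ω i).1) fun j => avg f - f j
  simp only [Equiv.coe_addLeft] at h
  rw [h, sum_sub_avg, mul_zero]

theorem sum_increment_odd [NeZero N] (f : Fin N → C(K, ℝ)) (i : Fin k)
    (ω : Fin k → Fin N × Fin 2) (x : C(K, ℝ)) :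
    ∑ s : Fin 2, increment f (2 * i + 1) (shift i (0, s) ω) x = 0 := by
  simp only [increment_odd, shift_apply_same, Prod.fst_add, Prod.snd_add, add_zero,
    ← Finset.sum_smul]
  have h := Equiv.sum_comp (Equiv.addLeft (ω i).2) sgn
  simp only [Equiv.coe_addLeft] at h
  rw [h]
  simp [sgn]

/-- The uniform martingale setup associated with `agree`. -/
noncomputable def setup (k N : ℕ) :
    MartingaleSetup (Fin k → Fin N × Fin 2) (ProbabilityTheory.uniformOn Set.univ) :=
  .ofSetoids _ (agree k N) (agree_succ_le k N)

theorem isSimpleMartingale_process [CompactSpace K] [NeZero N] (f : Fin N → C(K, ℝ)) :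
    IsSimpleMartingale (setup k N) (process f) := by
  refine ⟨fun n E hE ω hω ω' hω' => ?_, fun n hn E hE φ => ?_⟩
  · obtain ⟨y, rfl⟩ := MartingaleSetup.mem_part_ofSetoids.1 hE
    exact process_congr f ((agree k N n).trans' hω ((agree k N n).symm' hω'))
  · obtain ⟨n, rfl⟩ : ∃ m, n = m + 1 := ⟨n - 1, by omega⟩
    rw [Nat.add_sub_cancel] at hE ⊢
    simp only [process_sub]
    by_cases hnk : 2 * k ≤ n
    · simp [increment_of_le f hnk]
    obtain ⟨i, hi⟩ : ∃ i : Fin k, n = 2 * i ∨ n = 2 * i + 1 :=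
      ⟨⟨n / 2, by omega⟩, by simp only; omega⟩
    obtain rfl | rfl := hi
    · refine setIntegral_uniformOn_eq_zero_of_sum_perm (fun t : Fin N => shift i (t, 0)) E
        (fun t ω => hE.mem_iff_of_rel (agree_shift_even i _ ω)) _ fun ω => ?_
      simp only [process_congr f (agree_shift_even i _ ω)]
      rw [← map_sum, sum_increment_even, map_zero]
    · refine setIntegral_uniformOn_eq_zero_of_sum_perm (fun s : Fin 2 => shift i (0, s)) E
        (fun s ω => hE.mem_iff_of_rel (agree_shift_odd i _ ω)) _ fun ω => ?_
      simp only [process_congr f (agree_shift_odd i _ ω)]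
      rw [← map_sum, sum_increment_odd, map_zero]

theorem wpUnion_setup [NeZero N] (i : Fin k) :
    (setup k N).wpUnion (2 * i + 2) = Set.univ := by
  refine Set.eq_univ_of_forall fun ω => ?_
  let E : Set (Fin k → Fin N × Fin 2) := {x | agree k N (2 * i + 2) x ω}
  let E' : Set (Fin k → Fin N × Fin 2) := {x | agree k N (2 * i + 2) x (shift i (0, 1) ω)}
  have hE' : E' = shift i (0, 1) '' E := by
    ext x
    rw [Equiv.image_eq_preimage_symm, Set.mem_preimage]
    obtain ⟨y, rfl⟩ := (shift i (0, 1)).surjective x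
    simp only [Equiv.symm_apply_apply, E, E', Set.mem_ofPred_eq, agree_iff]
    refine forall_congr' fun j => ?_
    by_cases h : j = i
    · subst h
      simp [shift_apply_same]
    · simp [shift_apply_ne h]
  have hunion : E ∪ E' = {x | agree k N (2 * i + 1) x ω} := by
    ext x
    simp only [E, E', Set.mem_union, Set.mem_ofPred_eq]
    refine ⟨?_, fun h => ?_⟩
    · rintro (h | h)
      · exact agree_succ_le _ _ _ h
      · exact (agree k N _).trans' (agree_succ_le _ _ _ h) (agree_shift_odd i 1 ω)
    · have hs : (x i).2 = (ω i).2 ∨ (x i).2 = (ω i).2 + 1 := by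
        generalize (x i).2 = a
        generalize (ω i).2 = b
        revert a b
        decide
      simp only [agree_iff] at h ⊢
      have hlt : ∀ j : Fin k, j ≠ i → 2 * (j : ℕ) + 1 < 2 * i + 2 →
          2 * (j : ℕ) + 1 < 2 * i + 1 := by
        intro j hj h
        have := Fin.val_ne_of_ne hj
        omega
      refine hs.imp (fun hs j => ?_) fun hs j => ?_ <;> by_cases hj : j = i
      · subst hj
        exact ⟨fun _ => (h j).1 (by omega), fun _ => hs⟩
      · exact ⟨fun h' => (h j).1 (by omega), fun h' => (h j).2 (hlt j hj h')⟩
      · subst hj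
        simpa [shift_apply_same, hs] using (h j).1 (by omega)
      · rw [shift_apply_ne hj]
        exact ⟨fun h' => (h j).1 (by omega), fun h' => (h j).2 (hlt j hj h')⟩
  refine ⟨E, ⟨E, E', MartingaleSetup.mem_part_ofSetoids.2 ⟨_, rfl⟩,
    MartingaleSetup.mem_part_ofSetoids.2 ⟨_, rfl⟩, ?_, ?_, Or.inl rfl⟩, (agree k N _).refl' ω⟩
  · rw [hE', uniformOn_univ_image_equiv]
  · rw [hunion]
    exact MartingaleSetup.mem_part_ofSetoids.2 ⟨_, rfl⟩

theorem abs_process_even_le {f : Fin N → C(K, ℝ)} {δ : ℝ} (h0 : ∀ j x, 0 ≤ f j x)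
    (h1 : ∀ j x, f j x ≤ 1) (hδ : ∀ x, avg f x ≤ δ) (ω : Fin k → Fin N × Fin 2)
    {m : ℕ} (hm : m ≤ k) (x : K) :
    |process f (2 * m) ω x| ≤ (1 + δ) ^ m ∧
      (m < k → |process f (2 * m + 1) ω x| ≤ (1 + δ) ^ (m + 1)) := by
  have ha : 0 ≤ avg f x := by
    simp only [avg, ContinuousMap.smul_apply, ContinuousMap.coe_sum, Finset.sum_apply, smul_eq_mul]
    exact mul_nonneg (by positivity) (Finset.sum_nonneg fun j _ => h0 j x)
  have hδx := hδ x
  have hδ0 : 0 ≤ δ := ha.trans hδx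
  have step : ∀ m (hmk : m < k), |process f (2 * m) ω x| ≤ (1 + δ) ^ m →
      |process f (2 * m + 1) ω x| ≤ (1 + δ) ^ (m + 1) - f (ω ⟨m, hmk⟩).1 x := by
    intro m hmk hb
    have e : process f (2 * m + 1) ω x
        = process f (2 * m) ω x * (1 - f (ω ⟨m, hmk⟩).1 x + avg f x) := by
      have := increment_even f ⟨m, hmk⟩ ω (process f (2 * m) ω)
      simp only at this
      simp only [process, this, ContinuousMap.add_apply, ContinuousMap.mul_apply,
        ContinuousMap.sub_apply]
      ring
    set u := f (ω ⟨m, hmk⟩).1 x with hu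
    have hu0 : 0 ≤ u := h0 _ _
    have hu1 : u ≤ 1 := h1 _ _
    have hR : 1 ≤ (1 + δ) ^ m := one_le_pow₀ (by linarith)
    have hc : 0 ≤ 1 - u + avg f x := by linarith
    rw [e, abs_mul, abs_of_nonneg hc]
    calc |process f (2 * m) ω x| * (1 - u + avg f x)
        ≤ (1 + δ) ^ m * (1 - u + δ) := by gcongr
      _ ≤ (1 + δ) ^ (m + 1) - u := by
        rw [pow_succ]
        nlinarith
  induction m with
  | zero =>
    have hz : |process f (2 * 0) ω x| ≤ (1 + δ) ^ 0 := by simp [process]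
    exact ⟨hz, fun hk => (step 0 hk hz).trans (sub_le_self _ (h0 _ _))⟩
  | succ m ih =>
    have hmk : m < k := hm
    have hy := step m hmk (ih hmk.le).1
    have hx : |process f (2 * (m + 1)) ω x| ≤ (1 + δ) ^ (m + 1) := by
      have e : process f (2 * (m + 1)) ω x = process f (2 * m + 1) ω x
          + sgn (ω ⟨m, hmk⟩).2 * f (ω ⟨m, hmk⟩).1 x := by
        have := increment_odd f ⟨m, hmk⟩ ω (process f (2 * m + 1) ω)
        simp only at this
        rw [show 2 * (m + 1) = (2 * m + 1) + 1 by ring, process, this]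
        simp
      rw [e]
      refine (abs_add_le _ _).trans ?_
      rw [abs_mul, abs_sgn, one_mul, abs_of_nonneg (h0 _ _)]
      linarith
    exact ⟨hx, fun hk => (step _ hk hx).trans (sub_le_self _ (h0 _ _))⟩

theorem process_of_le (f : Fin N → C(K, ℝ)) {n : ℕ} (hn : 2 * k ≤ n)
    (ω : Fin k → Fin N × Fin 2) : process f n ω = process f (2 * k) ω := by
  induction n, hn using Nat.le_induction with
  | base => rfl
  | succ n hn ih => rw [process, increment_of_le f hn, add_zero, ih]

theorem norm_process_le [CompactSpace K] {f : Fin N → C(K, ℝ)} {δ : ℝ} (hδ0 : 0 ≤ δ) (h0 : ∀ j x, 0 ≤ f j x)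
    (h1 : ∀ j x, f j x ≤ 1) (hδ : ∀ x, avg f x ≤ δ) (n : ℕ) (ω : Fin k → Fin N × Fin 2) :
    ‖process f n ω‖ ≤ (1 + δ) ^ k := by
  have hone : 1 ≤ 1 + δ := by linarith
  refine (ContinuousMap.norm_le _ (by positivity)).2 fun x => ?_
  rw [Real.norm_eq_abs]
  by_cases hn : 2 * k ≤ n
  · rw [process_of_le f hn]
    exact (abs_process_even_le h0 h1 hδ ω le_rfl x).1
  have hm : n / 2 < k := by omega
  obtain ⟨ha, hb⟩ := abs_process_even_le h0 h1 hδ ω hm.le x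
  rcases Nat.mod_two_eq_zero_or_one n with h | h
  · rw [show n = 2 * (n / 2) by omega]
    exact ha.trans (pow_le_pow_right₀ hone hm.le)
  · rw [show n = 2 * (n / 2) + 1 by omega]
    exact (hb hm).trans (pow_le_pow_right₀ hone hm)

theorem memXi_process [CompactSpace K] [NeZero N] {f : Fin N → C(K, ℝ)} (hf : ∀ j, ‖f j‖ = 1)
    {H : Set C(K, ℝ)} (hH : IsHomogeneous H) (hfH : ∀ j, f j ∈ H) :
    MemXi (setup k N) (process f) H k := by
  refine ⟨Finset.univ.image fun i : Fin k => 2 * (i : ℕ) + 2, fun _ => Set.univ, ?_, ?_⟩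
  · rw [Finset.card_image_of_injective _ fun i j h => Fin.ext (by grind)]
    simp
  · intro n hn
    obtain ⟨i, -, rfl⟩ := Finset.mem_image.1 hn
    rw [wpUnion_setup]
    have e : ∀ ω : Fin k → Fin N × Fin 2, process f (2 * i + 2) ω
        - process f (2 * i + 2 - 1) ω = sgn (ω i).2 • f (ω i).1 := fun ω =>
      (process_sub f (2 * i + 1) ω).trans (increment_odd f i ω _)
    refine ⟨by omega, MeasurableSet.univ, fun ω _ => ?_, ?_⟩
    · rw [e]
      exact hH _ (hfH _) _
    · simp only [e]
      simp [norm_smul, abs_sgn, hf]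

end AlternatingMartingale

open AlternatingMartingale in
/-- A finite family of norm-one functions with values in `[0, 1]` and with small average gives
a martingale of norm close to one with `k` increments `± f j`. -/
theorem exists_martingaleData_of_avg_le {K : Type*} [TopologicalSpace K] [CompactSpace K]
    {N : ℕ} [NeZero N] {f : Fin N → C(K, ℝ)} {δ : ℝ} (hδ0 : 0 ≤ δ) (h0 : ∀ j x, 0 ≤ f j x)
    (h1 : ∀ j x, f j x ≤ 1) (hf : ∀ j, ‖f j‖ = 1) (hδ : ∀ x, avg f x ≤ δ)
    {H : Set C(K, ℝ)} (hH : IsHomogeneous H) (hfH : ∀ j, f j ∈ H) (k : ℕ) :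
    ∃ T : MartingaleData C(K, ℝ), MemXi T.S T.M H k ∧
      ∀ n, ∫ ω, ‖T.M n ω‖ ^ 2 ∂T.p ≤ ((1 + δ) ^ k) ^ 2 := by
  refine ⟨⟨Fin k → Fin N × Fin 2, ProbabilityTheory.uniformOn Set.univ, inferInstance, setup k N,
    process f, isSimpleMartingale_process f⟩, memXi_process hf hH hfH, fun n => ?_⟩
  refine (integral_mono_of_nonneg (.of_forall fun ω => sq_nonneg _)
    (integrable_const (((1 + δ) ^ k) ^ 2)) (.of_forall fun ω => ?_)).trans_eq ?_
  · exact pow_le_pow_left₀ (norm_nonneg _) (norm_process_le hδ0 h0 h1 hδ n ω) 2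
  · simp

theorem card_filter_mem_le_interNum {α : Type*} (D : Finset (Set α)) (x : α)
    [DecidablePred fun G : Set α => x ∈ G] : (D.filter fun G => x ∈ G).card ≤ interNum D := by
  have hne : {k : ℕ | ∀ A : Finset (Set α), A ⊆ D → k < A.card →
      ⋂₀ (↑A : Set (Set α)) = ∅}.Nonempty :=
    ⟨D.card, fun A hA hlt => absurd (Finset.card_le_card hA) (not_le.2 hlt)⟩
  by_contra! hlt
  have h := Nat.sInf_mem hne _ (Finset.filter_subset (fun G => x ∈ G) D) hlt
  have hx : x ∈ ⋂₀ (↑(D.filter fun G => x ∈ G) : Set (Set α)) :=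
    fun G hG => (Finset.mem_filter.1 hG).2
  rw [h] at hx
  exact hx

/-- If `wiñ(𝒢) = 0` and `H` is a homogeneous set containing `ℱ_𝒢`, then `a(H) ≤ 1`:
for every `k ≥ 1` and `ε > 0` there is a martingale in `Ξ̃_k(H)` with
`sup_n E‖M_n‖² ≤ (1 + ε)²`. -/
theorem stmt18 {K : Type*} [TopologicalSpace K] [CompactSpace K] [T2Space K]
    (fG : Set K → C(K, ℝ))
    (hfG : ∀ G : Set K, IsOpen G → G.Nonempty →
      (∀ x, 0 ≤ fG G x) ∧ (∀ x, fG G x ≤ 1) ∧ ‖fG G‖ = 1 ∧ ∀ x ∉ G, fG G x = 0)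
    (𝒢 : Set (Set K)) (h𝒢 : ∀ G ∈ 𝒢, IsOpen G ∧ G.Nonempty)
    (hwtin : ∀ ε : ℝ, 0 < ε → ∃ D : Finset (Set K), ↑D ⊆ 𝒢 ∧ 2 ≤ D.card ∧
      (interNum D : ℝ) / ((D.card : ℝ) - 1) < ε)
    (H : Set C(K, ℝ)) (hH : IsHomogeneous H) (hHF : ∀ G ∈ 𝒢, fG G ∈ H)
    (k : ℕ) (hk : 1 ≤ k) (ε : ℝ) (hε : 0 < ε) :
    ∃ T : MartingaleData C(K, ℝ),
      MemXi T.S T.M H k ∧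
      ∀ n, ∫ ω, ‖T.M n ω‖ ^ 2 ∂T.p ≤ (1 + ε) ^ 2 := by
  classical
  obtain ⟨δ, hδ, hδε⟩ : ∃ δ : ℝ, 0 < δ ∧ (1 + δ) ^ k < 1 + ε := by
    have hc : Tendsto (fun δ : ℝ => (1 + δ) ^ k) (𝓝[>] 0) (𝓝 ((1 + 0) ^ k)) :=
      (Continuous.tendsto (by fun_prop) 0).mono_left nhdsWithin_le_nhds
    have hev := hc.eventually_lt_const (u := 1 + ε) (by simpa using hε)
    obtain ⟨δ, h1, h2⟩ := (hev.and self_mem_nhdsWithin).exists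
    exact ⟨δ, h2, h1⟩
  obtain ⟨D, hD𝒢, hDcard, hDδ⟩ := hwtin δ hδ
  have : NeZero D.card := ⟨by omega⟩
  let e := D.equivFin
  let f : Fin D.card → C(K, ℝ) := fun j => fG (e.symm j)
  have hmem : ∀ j, (e.symm j : Set K) ∈ 𝒢 := fun j => hD𝒢 (e.symm j).2
  have hprop : ∀ G ∈ 𝒢, _ := fun G hG => hfG G (h𝒢 G hG).1 (h𝒢 G hG).2
  have hcard : (2 : ℝ) ≤ D.card := by exact_mod_cast hDcard
  have havg : ∀ x, AlternatingMartingale.avg f x ≤ δ := by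
    intro x
    have hsum : ∑ j, f j x ≤ interNum D := by
      calc ∑ j, f j x = ∑ G : D, fG G x := Equiv.sum_comp e.symm fun G : D => fG G x
        _ = ∑ G ∈ D, fG G x := Finset.sum_coe_sort D fun G => fG G x
        _ ≤ ∑ G ∈ D, if x ∈ G then (1 : ℝ) else 0 := by
          refine Finset.sum_le_sum fun G hG => ?_
          obtain ⟨-, hle, -, hz⟩ := hprop G (hD𝒢 hG)
          split_ifs with hx
          · exact hle x
          · exact (hz x hx).le
        _ = (D.filter fun G => x ∈ G).card := by rw [Finset.sum_boole]
        _ ≤ interNum D := by exact_mod_cast card_filter_mem_le_interNum D x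
    rw [div_lt_iff₀ (by linarith)] at hDδ
    simp only [AlternatingMartingale.avg, ContinuousMap.smul_apply, ContinuousMap.coe_sum,
      Finset.sum_apply, smul_eq_mul]
    rw [inv_mul_le_iff₀ (by linarith)]
    nlinarith
  obtain ⟨T, hT, hbound⟩ := exists_martingaleData_of_avg_le hδ.le
    (fun j => (hprop _ (hmem j)).1) (fun j => (hprop _ (hmem j)).2.1)
    (fun j => (hprop _ (hmem j)).2.2.1) havg hH (fun j => hHF _ (hmem j)) k
  exact ⟨T, hT, fun n => (hbound n).trans (pow_le_pow_left₀ (by positivity) hδε.le 2)⟩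
end
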